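/- (Lemma 2: derivative of the auxiliary function.) For every t ∈ (0,T), dJ(t)/dt = 2∫₀^ℓ m(x) u_t(x,t)² dx − 2E(t). -/

import Mathlib

open Set intervalIntegral

noncomputable def pdx (u : ℝ → ℝ → ℝ) (x t : ℝ) : ℝ := deriv (fun y => u y t) x
noncomputable def pdt (u : ℝ → ℝ → ℝ) (x t : ℝ) : ℝ := deriv (fun s => u x s) t

noncomputable def beamEnergy (m r : ℝ → ℝ) (krm krp ℓ : ℝ) (u : ℝ → ℝ → ℝ) (t : ℝ) : ℝ :=
  (1/2) * (∫ x in (0:ℝ)..ℓ, (m x * (pdt u x t)^2 + r x * (pdx (pdx u) x t)^2))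
    + (1/2) * krm * (pdx u 0 t)^2 + (1/2) * krp * (pdx u ℓ t)^2

noncomputable def beamJ (m μ : ℝ → ℝ) (kam kap ℓ : ℝ) (u : ℝ → ℝ → ℝ) (t : ℝ) : ℝ :=
  (∫ x in (0:ℝ)..ℓ, m x * u x t * pdt u x t)
    + (1/2) * (∫ x in (0:ℝ)..ℓ, μ x * (u x t)^2)
    + (1/2) * kam * (pdx u 0 t)^2 + (1/2) * kap * (pdx u ℓ t)^2

open MeasureTheory Topology in
/-- Differentiation under the integral sign for a continuously differentiable kernel with a
continuous weight. -/
theorem hasDerivAt_integral_mul_of_continuousOn {a b : ℝ} (hab : a ≤ b) {w : ℝ → ℝ}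
    (hw : ContinuousOn w (Icc a b)) {g g' : ℝ → ℝ → ℝ}
    (hg : Continuous (Function.uncurry g)) (hg' : Continuous (Function.uncurry g'))
    (hgg' : ∀ x t, HasDerivAt (fun s => g x s) (g' x t) t) (t : ℝ) :
    HasDerivAt (fun s => ∫ x in a..b, w x * g x s) (∫ x in a..b, w x * g' x t) t := by
  have hgx : ∀ s, Continuous fun x => g x s :=
    fun s => hg.comp (by fun_prop : Continuous fun x => (x, s))
  have hgx' : ∀ s, Continuous fun x => g' x s :=
    fun s => hg'.comp (by fun_prop : Continuous fun x => (x, s))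
  have hint : ∀ {f : ℝ → ℝ}, Continuous f → IntervalIntegrable (fun x => w x * f x) volume a b :=
    fun hf => (hw.mul hf.continuousOn).intervalIntegrable_of_Icc hab
  obtain ⟨C, hC⟩ := (isCompact_Icc.prod (isCompact_closedBall t 1) :
    IsCompact (Icc a b ×ˢ Metric.closedBall t 1)).exists_bound_of_continuousOn hg'.continuousOn
  refine (hasDerivAt_integral_of_dominated_loc_of_deriv_le
    (F := fun s x => w x * g x s) (F' := fun s x => w x * g' x s)
    (bound := fun x => |w x| * C) (Metric.closedBall_mem_nhds t one_pos)
    (.of_forall fun s => (hint (hgx s)).aestronglyMeasurable_restrict_uIoc)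
    (hint (hgx t)) (hint (hgx' t)).aestronglyMeasurable_restrict_uIoc
    (.of_forall fun x hx s hs => ?_)
    ((hw.abs.mul continuousOn_const).intervalIntegrable_of_Icc hab)
    (.of_forall fun x _ s _ => (hgg' x s).const_mul (w x))).2
  rw [uIoc_of_le hab] at hx
  rw [norm_mul, Real.norm_eq_abs]
  exact mul_le_mul_of_nonneg_left (hC (x, s) ⟨Ioc_subset_Icc_self hx, hs⟩) (abs_nonneg _)

theorem hasDerivAt_pdx_fderiv {u : ℝ → ℝ → ℝ}
    (hu : ContDiff ℝ (⊤ : ℕ∞) (Function.uncurry u))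
    (x t : ℝ) :
    HasDerivAt (fun y => u y t) (fderiv ℝ (Function.uncurry u) (x, t) (1, 0)) x :=
  ((hu.differentiable (by simp)) (x, t)).hasFDerivAt.comp_hasDerivAt
    (f := fun y => (y, t)) x ((hasDerivAt_id x).prodMk (hasDerivAt_const x t))

theorem hasDerivAt_pdt_fderiv {u : ℝ → ℝ → ℝ}
    (hu : ContDiff ℝ (⊤ : ℕ∞) (Function.uncurry u))
    (x t : ℝ) :
    HasDerivAt (fun s => u x s) (fderiv ℝ (Function.uncurry u) (x, t) (0, 1)) t :=
  ((hu.differentiable (by simp)) (x, t)).hasFDerivAt.comp_hasDerivAt t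
    ((hasDerivAt_const t x).prodMk (hasDerivAt_id t))

theorem hasDerivAt_pdx {u : ℝ → ℝ → ℝ}
    (hu : ContDiff ℝ (⊤ : ℕ∞) (Function.uncurry u))
    (x t : ℝ) :
    HasDerivAt (fun y => u y t) (pdx u x t) x :=
  (hasDerivAt_pdx_fderiv hu x t).differentiableAt.hasDerivAt

theorem hasDerivAt_pdt {u : ℝ → ℝ → ℝ}
    (hu : ContDiff ℝ (⊤ : ℕ∞) (Function.uncurry u))
    (x t : ℝ) :
    HasDerivAt (fun s => u x s) (pdt u x t) t :=
  (hasDerivAt_pdt_fderiv hu x t).differentiableAt.hasDerivAt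

theorem contDiff_pdx {u : ℝ → ℝ → ℝ}
    (hu : ContDiff ℝ (⊤ : ℕ∞) (Function.uncurry u)) :
    ContDiff ℝ (⊤ : ℕ∞) (Function.uncurry (pdx u)) := by
  have h : Function.uncurry (pdx u) = fun p => fderiv ℝ (Function.uncurry u) p (1, 0) :=
    funext fun p => (hasDerivAt_pdx_fderiv hu p.1 p.2).deriv
  rw [h]
  exact (hu.fderiv_right (by simp)).clm_apply contDiff_const

theorem contDiff_pdt {u : ℝ → ℝ → ℝ}
    (hu : ContDiff ℝ (⊤ : ℕ∞) (Function.uncurry u)) :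
    ContDiff ℝ (⊤ : ℕ∞) (Function.uncurry (pdt u)) := by
  have h : Function.uncurry (pdt u) = fun p => fderiv ℝ (Function.uncurry u) p (0, 1) :=
    funext fun p => (hasDerivAt_pdt_fderiv hu p.1 p.2).deriv
  rw [h]
  exact (hu.fderiv_right (by simp)).clm_apply contDiff_const

theorem continuous_section {u : ℝ → ℝ → ℝ}
    (hu : ContDiff ℝ (⊤ : ℕ∞) (Function.uncurry u))
    (t : ℝ) : Continuous fun x => u x t :=
  hu.continuous.comp (by fun_prop : Continuous fun x : ℝ => (x, t))

/-- Integrating by parts twice in space. -/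
theorem integral_mul_pdx_pdx {u : ℝ → ℝ → ℝ}
    (hu : ContDiff ℝ (⊤ : ℕ∞) (Function.uncurry u))
    {q : ℝ → ℝ → ℝ} (hq : ContDiff ℝ (⊤ : ℕ∞) (Function.uncurry q))
    (a b t : ℝ) :
    ∫ x in a..b, u x t * pdx (pdx q) x t =
      u b t * pdx q b t - u a t * pdx q a t - (pdx u b t * q b t - pdx u a t * q a t)
        + ∫ x in a..b, pdx (pdx u) x t * q x t := by
  have hux := contDiff_pdx hu
  have hqx := contDiff_pdx hq
  have hint {v : ℝ → ℝ → ℝ} (hv : ContDiff ℝ (⊤ : ℕ∞) (Function.uncurry v)) :=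
    (continuous_section hv t).intervalIntegrable (μ := MeasureTheory.volume) a b
  rw [integral_mul_deriv_eq_deriv_mul (fun x _ => hasDerivAt_pdx hu x t)
      (fun x _ => hasDerivAt_pdx hqx x t) (hint hux) (hint (contDiff_pdx hqx)),
    integral_mul_deriv_eq_deriv_mul (fun x _ => hasDerivAt_pdx hux x t)
      (fun x _ => hasDerivAt_pdx hq x t) (hint (contDiff_pdx hux)) (hint hqx)]
  ring

theorem auxiliary_function_derivative
    (ℓ T m₀ m₁ μ₀ μ₁ r₀ r₁ krm kam krp kap : ℝ)
    (m μ r : ℝ → ℝ) (u : ℝ → ℝ → ℝ)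
    (hℓ : 0 < ℓ) (hT : 0 < T)
    (hm₀ : 0 < m₀) (hμ₀ : 0 ≤ μ₀) (hr₀ : 0 < r₀)
    (hmc : ContinuousOn m (Icc 0 ℓ)) (hμc : ContinuousOn μ (Icc 0 ℓ))
    (hrc : ContinuousOn r (Icc 0 ℓ))
    (hmb : ∀ x ∈ Icc 0 ℓ, m₀ ≤ m x ∧ m x ≤ m₁)
    (hμb : ∀ x ∈ Icc 0 ℓ, μ₀ ≤ μ x ∧ μ x ≤ μ₁)
    (hrb : ∀ x ∈ Icc 0 ℓ, r₀ ≤ r x ∧ r x ≤ r₁)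
    (hkrm : 0 ≤ krm) (hkam : 0 ≤ kam) (hkrp : 0 ≤ krp) (hkap : 0 ≤ kap)
    (hu : ContDiff ℝ (⊤ : ℕ∞) (Function.uncurry u))
    (hq : ContDiff ℝ (⊤ : ℕ∞) (Function.uncurry (fun x t => r x * pdx (pdx u) x t)))
    (hpde : ∀ x ∈ Ioo 0 ℓ, ∀ t ∈ Ioo 0 T,
      m x * pdt (pdt u) x t + μ x * pdt u x t
        + pdx (pdx (fun y s => r y * pdx (pdx u) y s)) x t = 0)
    (hbu0 : ∀ t ∈ Icc 0 T, u 0 t = 0)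
    (hbuℓ : ∀ t ∈ Icc 0 T, u ℓ t = 0)
    (hbm0 : ∀ t ∈ Icc 0 T,
      -(r 0 * pdx (pdx u) 0 t) = -(krm * pdx u 0 t) - kam * pdt (pdx u) 0 t)
    (hbmℓ : ∀ t ∈ Icc 0 T,
      -(r ℓ * pdx (pdx u) ℓ t) = krp * pdx u ℓ t + kap * pdt (pdx u) ℓ t) :
    ∀ t ∈ Ioo 0 T,
      HasDerivAt (beamJ m μ kam kap ℓ u)
        (2 * (∫ x in (0:ℝ)..ℓ, m x * (pdt u x t)^2) - 2 * beamEnergy m r krm krp ℓ u t) t := by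
  intro t ht
  have htI : t ∈ Icc 0 T := Ioo_subset_Icc_self ht
  have hut := contDiff_pdt hu
  have hutt := contDiff_pdt hut
  have hux := contDiff_pdx hu
  have huxx := contDiff_pdx hux
  have hint {w : ℝ → ℝ} (hw : ContinuousOn w (Icc 0 ℓ)) {f : ℝ → ℝ} (hf : Continuous f) :
      IntervalIntegrable (fun x => w x * f x) MeasureTheory.volume 0 ℓ :=
    (hw.mul hf.continuousOn).intervalIntegrable_of_Icc hℓ.le
  have cu := continuous_section hu t
  have cut := continuous_section hut t
  have cutt := continuous_section hutt t
  have cuxx := continuous_section huxx t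
  have cqxx := continuous_section (contDiff_pdx (contDiff_pdx hq)) t
  have hkin := hasDerivAt_integral_mul_of_continuousOn hℓ.le hmc
    (g := fun x s => u x s * pdt u x s)
    (g' := fun x s => pdt u x s * pdt u x s + u x s * pdt (pdt u) x s)
    (hu.continuous.mul hut.continuous)
    ((hut.continuous.mul hut.continuous).add (hu.continuous.mul hutt.continuous))
    (fun x s => (hasDerivAt_pdt hu x s).mul (hasDerivAt_pdt hut x s)) t
  have hdamp := hasDerivAt_integral_mul_of_continuousOn hℓ.le hμc
    (g := fun x s => u x s ^ 2) (g' := fun x s => 2 * (u x s * pdt u x s))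
    ((continuous_pow 2).comp hu.continuous) ((hu.continuous.mul hut.continuous).const_mul 2)
    (fun x s => ((hasDerivAt_pdt hu x s).pow 2).congr_deriv (by push_cast; ring)) t
  have hJ := ((hkin.add (hdamp.const_mul (1 / 2))).add
    (((hasDerivAt_pdt hux 0 t).pow 2).const_mul (1 / 2 * kam))).add
    (((hasDerivAt_pdt hux ℓ t).pow 2).const_mul (1 / 2 * kap))
  have hJ_eq : beamJ m μ kam kap ℓ u = _ := funext fun s => by
    simp only [beamJ, mul_assoc (m _)]; rfl
  rw [hJ_eq]
  refine hJ.congr_deriv ?_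
  have hbalance : (∫ x in (0:ℝ)..ℓ, m x * (pdt u x t * pdt u x t + u x t * pdt (pdt u) x t))
      + 1 / 2 * (∫ x in (0:ℝ)..ℓ, μ x * (2 * (u x t * pdt u x t)))
      = (∫ x in (0:ℝ)..ℓ, m x * pdt u x t ^ 2)
        - ∫ x in (0:ℝ)..ℓ, u x t * pdx (pdx fun y s => r y * pdx (pdx u) y s) x t := by
    rw [← integral_const_mul, ← integral_add (hint hmc (by fun_prop))
        ((hint hμc (by fun_prop)).const_mul _),
      ← integral_sub (hint hmc (f := fun x => pdt u x t ^ 2) (by fun_prop))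
        (Continuous.intervalIntegrable (by fun_prop) _ _)]
    refine integral_congr_Ioo_of_le hℓ.le fun x hx => ?_
    linear_combination u x t * hpde x hx t ht
  have hparts := integral_mul_pdx_pdx hu hq 0 ℓ t
  have hbend : (∫ x in (0:ℝ)..ℓ, pdx (pdx u) x t * (r x * pdx (pdx u) x t))
      = ∫ x in (0:ℝ)..ℓ, r x * pdx (pdx u) x t ^ 2 := by
    congr 1 with x
    ring
  have hsplit := integral_add (hint hmc (cut.pow 2)) (hint hrc (cuxx.pow 2))
  rw [hbend, hbu0 t htI, hbuℓ t htI] at hparts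
  simp only [Pi.pow_apply] at hsplit
  rw [hbalance, hparts, beamEnergy, hsplit]
  push_cast
  linear_combination pdx u ℓ t * -hbmℓ t htI + pdx u 0 t * hbm0 t htI
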